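/- arXiv:0910.2470 — 2 statements merged into one kernel-verified Lean document; each statement's English description precedes it below -/
import Mathlib

section
/- Fix β > 0 and an open interval I ⊂ (0,∞) of connectivities. Assume: (i) for every α ∈ I the thermodynamic limit A(α,β) = lim_{N→∞} A_N(α,β) exists and α ↦ A(α,β) is differentiable on I; (ii) the derivatives converge, ∂_α A_N(α,β) → ∂_α A(α,β) for every α ∈ I; (iii) with α̃_N = Nα/(N+1), the limit Ψ(α,β,1) = lim_{N→∞} Ψ_N(α̃_N,β,1) exists. Then for every α ∈ I, A(α,β) = ln 2 − α ∂_α A(α,β) + Ψ(α,β,1). -/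
open scoped BigOperators

noncomputable section

/-- The Poisson probability mass function with mean `lam`. -/
def pois (lam : ℝ) (k : ℕ) : ℝ := Real.exp (-lam) * lam ^ k / (Nat.factorial k)

/-- The spin value (±1) attached to a Boolean opinion. -/
def spin (b : Bool) : ℝ := if b then 1 else -1

/-- Average of `f` over `p` families of `k` i.i.d. indices, each uniform on `Fin N`. -/
def avgIdx (N : ℕ) (p k : ℕ) (f : (Fin p → Fin k → Fin N) → ℝ) : ℝ :=
  ((N : ℝ) ^ (p * k))⁻¹ * ∑ im : Fin p → Fin k → Fin N, f im

/-- The interaction sum `∑_{ν=1}^k σ_{i_ν^1} ⋯ σ_{i_ν^p}`; the Hamiltonian is its negative. -/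
def intSum {N p k : ℕ} (im : Fin p → Fin k → Fin N) (σ : Fin N → Bool) : ℝ :=
  ∑ ν : Fin k, ∏ l : Fin p, spin (σ (im l ν))

/-- The diluted `p`-spin Hamiltonian `H = -∑_{ν=1}^k σ_{i_ν^1} ⋯ σ_{i_ν^p}`. -/
def Hspin {N p k : ℕ} (im : Fin p → Fin k → Fin N) (σ : Fin N → Bool) : ℝ :=
  - intSum im σ

/-- Partition function `Z = ∑_σ e^{-β H(σ)}`. -/
def Zpart (β : ℝ) {N p k : ℕ} (im : Fin p → Fin k → Fin N) : ℝ :=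
  ∑ σ : Fin N → Bool, Real.exp (β * intSum im σ)

/-- Cavity term `∑_{ν=1}^{k'} σ_{i_ν^1} ⋯ σ_{i_ν^q}` (with `q = p - 1` families). -/
def cavSum {N q k' : ℕ} (im' : Fin q → Fin k' → Fin N) (σ : Fin N → Bool) : ℝ :=
  ∑ ν : Fin k', ∏ l : Fin q, spin (σ (im' l ν))

/-- Perturbed Boltzmann weight `exp(β(∑_ν σ_{i_ν^1}⋯σ_{i_ν^p} + ∑_ν σ_{i'_ν^1}⋯σ_{i'_ν^{q}}))`. -/
def wpert (β : ℝ) {N p k q k' : ℕ} (im : Fin p → Fin k → Fin N)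
    (im' : Fin q → Fin k' → Fin N) (σ : Fin N → Bool) : ℝ :=
  Real.exp (β * (intSum im σ + cavSum im' σ))

/-- Perturbed partition function. -/
def Zpert (β : ℝ) {N p k q k' : ℕ} (im : Fin p → Fin k → Fin N)
    (im' : Fin q → Fin k' → Fin N) : ℝ :=
  ∑ σ : Fin N → Bool, wpert β im im' σ

/-- Replicated (unperturbed) Boltzmann state `Ω(g)` on `s` replicas sharing the same disorder. -/
def OmegaB (β : ℝ) {N p k : ℕ} (im : Fin p → Fin k → Fin N)
    (s : ℕ) (g : (Fin s → Fin N → Bool) → ℝ) : ℝ :=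
  (∑ σs : Fin s → Fin N → Bool, g σs * ∏ a : Fin s, Real.exp (β * intSum im (σs a))) /
    (Zpart β im) ^ s

/-- Replicated perturbed Boltzmann state `Ω̃_t(g)` on `s` replicas sharing the same disorder. -/
def OmegaPert (β : ℝ) {N p k q k' : ℕ} (im : Fin p → Fin k → Fin N)
    (im' : Fin q → Fin k' → Fin N) (s : ℕ) (g : (Fin s → Fin N → Bool) → ℝ) : ℝ :=
  (∑ σs : Fin s → Fin N → Bool, g σs * ∏ a : Fin s, wpert β im im' (σs a)) /
    (Zpert β im im') ^ s

/-- Quenched expectation: the number of interaction terms is Poisson of mean `γ N` and the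
`p` index families are i.i.d. uniform on `Fin N`. -/
def Equench (N p : ℕ) (γ : ℝ) (f : (k : ℕ) → (Fin p → Fin k → Fin N) → ℝ) : ℝ :=
  ∑' k : ℕ, pois (γ * N) k * avgIdx N p k (fun im => f k im)

/-- Quenched expectation including the cavity randomness: the cavity term has a Poisson
number of terms of mean `2 γ t`, with `p - 1` independent uniform index families. -/
def EquenchCav (N p : ℕ) (γ t : ℝ)
    (f : (k : ℕ) → (Fin p → Fin k → Fin N) →
         (k' : ℕ) → (Fin (p - 1) → Fin k' → Fin N) → ℝ) : ℝ :=
  ∑' k : ℕ, pois (γ * N) k * avgIdx N p k (fun im =>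
    ∑' k' : ℕ, pois (2 * γ * t) k' * avgIdx N (p - 1) k' (fun im' => f k im k' im'))

/-- Quenched average of `ln Z_N`. -/
def ElnZ (N p : ℕ) (γ β : ℝ) : ℝ :=
  Equench N p γ (fun _ im => Real.log (Zpart β im))

/-- Quenched pressure `A_N = (1/N) E[ln Z_N]`. -/
def pressure (N p : ℕ) (γ β : ℝ) : ℝ :=
  (N : ℝ)⁻¹ * ElnZ N p γ β

/-- Cavity function `Ψ_N(t) = E[ln (Z_{N,t} / Z_N)]`. -/
def cavityFn (N p : ℕ) (γ β t : ℝ) : ℝ :=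
  EquenchCav N p γ t (fun _ im _ im' => Real.log (Zpert β im im' / Zpart β im))

/-- The multi-overlap `q_{1…n} = (1/N) ∑_i σ_i^{(1)} ⋯ σ_i^{(n)}` of `n` replicas. -/
def qOv (N n : ℕ) (σs : Fin n → Fin N → Bool) : ℝ :=
  (N : ℝ)⁻¹ * ∑ x : Fin N, ∏ a : Fin n, spin (σs a x)

/-- Total (quenched) average `⟨q_{1…n}^r⟩_N` of the `r`-th power of the `n`-replica overlap. -/
def qPowAvg (N p : ℕ) (γ β : ℝ) (n r : ℕ) : ℝ :=
  Equench N p γ (fun _ im => OmegaB β im n (fun σs => (qOv N n σs) ^ r))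

/-- Perturbed total average `⟨q_{1…n}^r⟩_{N,t}` of the `r`-th power of the `n`-replica overlap. -/
def qPowAvgPert (N p : ℕ) (γ β t : ℝ) (n r : ℕ) : ℝ :=
  EquenchCav N p γ t (fun _ im _ im' => OmegaPert β im im' n (fun σs => (qOv N n σs) ^ r))

end

open Filter

noncomputable section CompoundPoisson

variable {V E ι : Type*} [NormedAddCommGroup V] [Fintype E] [Fintype ι]

/-- The operator `F ↦ ∑ₑ F(· + vₑ)` on functions on an additive group. -/
def jump (v : E → V) : Module.End ℝ (V → ℝ) :=
  ∑ e, LinearMap.funLeft ℝ ℝ (fun u => u + v e)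

lemma jump_apply (v : E → V) (F : V → ℝ) (u : V) : jump v F u = ∑ e, F (u + v e) := by
  simp [jump, LinearMap.funLeft]

lemma jump_commute (v : E → V) (w : ι → V) : Commute (jump v) (jump w) := by
  refine LinearMap.ext fun F => funext fun u => ?_
  simp only [Module.End.mul_apply, jump_apply]
  rw [Finset.sum_comm]
  simp only [add_right_comm]

lemma smul_jump_pow_apply (c : ℝ) (v : E → V) (k : ℕ) (F : V → ℝ) (u : V) :
    ((c • jump v) ^ k) F u = c ^ k * ∑ x : Fin k → E, F (u + ∑ ν, v (x ν)) := by
  induction k generalizing u with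
  | zero => simp
  | succ k ih =>
    rw [pow_succ', Module.End.mul_apply, LinearMap.smul_apply, Pi.smul_apply, jump_apply]
    simp only [ih]
    rw [← Finset.mul_sum, smul_eq_mul, ← mul_assoc, ← pow_succ',
      ← (Fin.consEquiv (fun _ : Fin (k + 1) => E)).sum_comp, Fintype.sum_prod_type]
    simp [Fin.sum_univ_succ, add_assoc]

/-- `F` grows at most like `C e^{‖u‖}`. -/
def ExpGrowth (C : ℝ) (F : V → ℝ) : Prop := ∀ u, |F u| ≤ C * Real.exp ‖u‖

/-- `A` is bounded by `K` for the weighted sup norm underlying `ExpGrowth`. -/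
def ExpBounded (K : ℝ) (A : Module.End ℝ (V → ℝ)) : Prop :=
  ∀ C F, ExpGrowth C F → ExpGrowth (K * C) (A F)

lemma ExpGrowth.add {C D : ℝ} {F G : V → ℝ} (hF : ExpGrowth C F) (hG : ExpGrowth D G) :
    ExpGrowth (C + D) (F + G) := fun u => by
  rw [add_mul]
  exact (abs_add_le _ _).trans (add_le_add (hF u) (hG u))

lemma ExpGrowth.smul {C : ℝ} {F : V → ℝ} (hF : ExpGrowth C F) (c : ℝ) :
    ExpGrowth (|c| * C) (c • F) := fun u => by
  rw [Pi.smul_apply, smul_eq_mul, abs_mul, mul_assoc]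
  exact mul_le_mul_of_nonneg_left (hF u) (abs_nonneg c)

lemma ExpGrowth.const (d : ℝ) : ExpGrowth |d| (fun _ : V => d) := fun u =>
  le_mul_of_one_le_right (abs_nonneg d) (Real.one_le_exp (norm_nonneg u))

lemma ExpBounded.add {K L : ℝ} {A B : Module.End ℝ (V → ℝ)} (hA : ExpBounded K A)
    (hB : ExpBounded L B) : ExpBounded (K + L) (A + B) := fun C F hF => by
  rw [add_mul]
  exact (hA C F hF).add (hB C F hF)

lemma ExpBounded.pow {K : ℝ} {A : Module.End ℝ (V → ℝ)} (hA : ExpBounded K A) (k : ℕ) :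
    ExpBounded (K ^ k) (A ^ k) := by
  induction k with
  | zero => intro C F hF; simpa using hF
  | succ k ih =>
    intro C F hF
    rw [pow_succ', pow_succ', mul_assoc]
    exact hA _ _ (ih C F hF)

lemma ExpBounded.smul_jump (c : ℝ) {v : E → V} (hv : ∀ e, ‖v e‖ ≤ 1) :
    ExpBounded (|c| * (Fintype.card E * Real.exp 1)) (c • jump v) := fun C F hF => by
  rw [mul_assoc]
  refine ExpGrowth.smul (fun u => ?_) c
  have hC : 0 ≤ C := by simpa using (abs_nonneg _).trans (hF 0)
  rw [jump_apply]
  calc |∑ e, F (u + v e)| ≤ ∑ e, |F (u + v e)| := Finset.abs_sum_le_sum_abs _ _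
    _ ≤ ∑ _e : E, C * (Real.exp ‖u‖ * Real.exp 1) := by
        refine Finset.sum_le_sum fun e _ => (hF _).trans (mul_le_mul_of_nonneg_left ?_ hC)
        rw [← Real.exp_add]
        exact Real.exp_le_exp.2 ((norm_add_le _ _).trans (by linarith [hv e]))
    _ = _ := by simp; ring

/-- The expectation `e^{-m} ∑ₖ (Aᵏ F)(u) / k!`; for `A = c • jump v` and `m = c |E|` this is
the mean of `F` at `u` plus a compound Poisson variable with jumps `v`. -/
def poissonMean {W : Type*} (m : ℝ) (A : Module.End ℝ (W → ℝ)) (F : W → ℝ) (u : W) : ℝ :=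
  ∑' k : ℕ, Real.exp (-m) / k.factorial * (A ^ k) F u

lemma ExpBounded.norm_term_le {K C : ℝ} {A : Module.End ℝ (V → ℝ)} {F : V → ℝ}
    (hA : ExpBounded K A) (hF : ExpGrowth C F) (m : ℝ) (u : V) (k : ℕ) :
    ‖Real.exp (-m) / k.factorial * (A ^ k) F u‖ ≤
      K ^ k / k.factorial * (Real.exp (-m) * C * Real.exp ‖u‖) := by
  rw [norm_mul, Real.norm_of_nonneg (by positivity : 0 ≤ Real.exp (-m) / (k.factorial : ℝ)),
    Real.norm_eq_abs]
  calc _ ≤ Real.exp (-m) / k.factorial * (K ^ k * C * Real.exp ‖u‖) :=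
        mul_le_mul_of_nonneg_left (hA.pow k C F hF u) (by positivity)
    _ = _ := by ring

lemma ExpBounded.summable {K C : ℝ} {A : Module.End ℝ (V → ℝ)} {F : V → ℝ}
    (hA : ExpBounded K A) (hF : ExpGrowth C F) (m : ℝ) (u : V) :
    Summable fun k : ℕ => Real.exp (-m) / k.factorial * (A ^ k) F u :=
  Summable.of_norm_bounded ((Real.summable_pow_div_factorial K).mul_right _)
    (hA.norm_term_le hF m u)

lemma ExpBounded.poissonMean {K C : ℝ} {A : Module.End ℝ (V → ℝ)} {F : V → ℝ}
    (hA : ExpBounded K A) (hF : ExpGrowth C F) (m : ℝ) :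
    ExpGrowth (Real.exp K * Real.exp (-m) * C) (poissonMean m A F) := fun u => by
  have h := tsum_of_norm_bounded
    ((Real.summable_pow_div_factorial K).hasSum.mul_right _) (hA.norm_term_le hF m u)
  rw [← Real.norm_eq_abs]
  refine h.trans_eq ?_
  rw [Real.exp_eq_exp_ℝ, congrFun (NormedSpace.exp_eq_tsum_div (𝔸 := ℝ)) K]
  ring

lemma poissonMean_add {K C D : ℝ} {A : Module.End ℝ (V → ℝ)} {F G : V → ℝ}
    (hA : ExpBounded K A) (hF : ExpGrowth C F) (hG : ExpGrowth D G) (m : ℝ) (u : V) :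
    poissonMean m A (F + G) u = poissonMean m A F u + poissonMean m A G u := by
  unfold poissonMean
  rw [← (hA.summable hF m u).tsum_add (hA.summable hG m u)]
  simp [mul_add]

lemma poissonMean_smul {W : Type*} (c m : ℝ) (A : Module.End ℝ (W → ℝ)) (F : W → ℝ) (u : W) :
    poissonMean m A (c • F) u = c * poissonMean m A F u := by
  unfold poissonMean
  rw [← tsum_mul_left]
  simp [mul_left_comm]

lemma hasSum_poisson (m : ℝ) :
    HasSum (fun k : ℕ => Real.exp (-m) / k.factorial * m ^ k) 1 := by
  have h := (NormedSpace.expSeries_div_hasSum_exp (𝔸 := ℝ) m).mul_left (Real.exp (-m))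
  rw [← Real.exp_eq_exp_ℝ, ← Real.exp_add, neg_add_cancel, Real.exp_zero] at h
  refine Eq.subst (motive := (HasSum · _)) (funext fun k => ?_) h
  ring

lemma hasSum_poisson_mean (m : ℝ) :
    HasSum (fun k : ℕ => Real.exp (-m) / k.factorial * m ^ k * k) m := by
  have h := (hasSum_poisson m).mul_left m
  rw [mul_one] at h
  rw [← hasSum_nat_add_iff' 1, Finset.sum_range_one, Nat.cast_zero, mul_zero, sub_zero]
  refine Eq.subst (motive := (HasSum · _)) (funext fun k => ?_) h
  rw [Nat.factorial_succ]
  push_cast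
  field_simp
  ring

lemma poissonMean_const (c d : ℝ) (v : E → V) (u : V) :
    poissonMean (c * Fintype.card E) (c • jump v) (fun _ => d) u = d := by
  have h := (hasSum_poisson (c * Fintype.card E)).mul_right d
  rw [one_mul] at h
  refine (tsum_congr fun k => ?_).trans h.tsum_eq
  rw [smul_jump_pow_apply]
  simp
  ring

lemma tsum_tsum_eq_tsum_antidiagonal {f : ℕ × ℕ → ℝ} (hf : Summable f) :
    ∑' i, ∑' j, f (i, j) = ∑' n, ∑ ij ∈ Finset.HasAntidiagonal.antidiagonal n, f ij := by
  rw [← hf.tsum_prod, ← Finset.HasAntidiagonal.sigmaAntidiagonalEquivProd.tsum_eq f]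
  refine (Finset.HasAntidiagonal.sigmaAntidiagonalEquivProd.summable_iff.2 hf).tsum_sigma.trans ?_
  refine tsum_congr fun n => ?_
  rw [tsum_fintype, Finset.sum_coe_sort_eq_attach, ← Finset.sum_attach (Finset.HasAntidiagonal.antidiagonal n)]
  rfl

/-- Poisson splitting: independent families of jumps can be averaged one after the other. -/
lemma poissonMean_split {L C c : ℝ} {v : E → V} (hv : ∀ e, ‖v e‖ ≤ 1)
    {B : Module.End ℝ (V → ℝ)} {F : V → ℝ} (hB : ExpBounded L B) (hF : ExpGrowth C F)
    (hAB : Commute (c • jump v) B) (m n : ℝ) (u : V) :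
    poissonMean (m + n) (c • jump v + B) F u =
      poissonMean m (c • jump v) (poissonMean n B F) u := by
  have hA := ExpBounded.smul_jump c hv
  set K := |c| * (Fintype.card E * Real.exp 1)
  set A := c • jump v with hAdef
  set f : ℕ × ℕ → ℝ := fun ij => Real.exp (-m) / ij.1.factorial *
    (Real.exp (-n) / ij.2.factorial * ((A ^ ij.1) ((B ^ ij.2) F)) u) with hf
  have hsum : Summable f := by
    have := ((Real.summable_pow_div_factorial K).abs).mul_of_nonneg
      ((Real.summable_pow_div_factorial L).abs) (fun _ => abs_nonneg _) (fun _ => abs_nonneg _)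
    refine Summable.of_norm_bounded
      (this.mul_right (Real.exp (-m) * Real.exp (-n) * C * Real.exp ‖u‖)) fun ij => ?_
    have h := hA.pow ij.1 _ _ (hB.pow ij.2 C F hF) u
    have hC : 0 ≤ C := by simpa using (abs_nonneg _).trans (hF 0)
    rw [hf, norm_mul, norm_mul, Real.norm_of_nonneg (by positivity : 0 ≤ Real.exp (-m) / (ij.1.factorial : ℝ)),
      Real.norm_of_nonneg (by positivity : 0 ≤ Real.exp (-n) / (ij.2.factorial : ℝ)), Real.norm_eq_abs]
    calc _ ≤ Real.exp (-m) / ij.1.factorial * (Real.exp (-n) / ij.2.factorial *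
          (K ^ ij.1 * (L ^ ij.2 * C) * Real.exp ‖u‖)) := by gcongr
      _ = (K ^ ij.1 / ij.1.factorial) * (L ^ ij.2 / ij.2.factorial) *
          (Real.exp (-m) * Real.exp (-n) * C * Real.exp ‖u‖) := by ring
      _ ≤ _ := by
        refine mul_le_mul_of_nonneg_right ?_ (by positivity)
        rw [← abs_mul]
        exact le_abs_self _
  have hright : poissonMean m A (poissonMean n B F) u = ∑' i, ∑' j, f (i, j) := by
    refine tsum_congr fun i => ?_
    simp only [hf]
    rw [tsum_mul_left]
    congr 1
    simp only [hAdef, smul_jump_pow_apply, poissonMean]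
    rw [← Summable.tsum_finsetSum fun x _ => hB.summable hF n _, ← tsum_mul_left]
    refine tsum_congr fun j => ?_
    rw [← Finset.mul_sum]
    ring
  rw [hright, tsum_tsum_eq_tsum_antidiagonal hsum]
  refine tsum_congr fun k => ?_
  rw [hAB.add_pow', LinearMap.sum_apply, Finset.sum_apply, Finset.mul_sum]
  refine Finset.sum_congr rfl fun ij hij => ?_
  rw [Finset.HasAntidiagonal.mem_antidiagonal] at hij
  subst hij
  rw [LinearMap.smul_apply, Pi.smul_apply, nsmul_eq_mul, Nat.cast_add_choose, neg_add,
    Real.exp_add, Module.End.mul_apply]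
  simp only [hf]
  have := Nat.factorial_pos (ij.1 + ij.2)
  field_simp

end CompoundPoisson

section Griffiths

variable {n : ℕ}

/-- Pointwise product of spin configurations. -/
def cfgMul (σ τ : Fin n → Bool) : Fin n → Bool := fun i => σ i == τ i

lemma cfgMul_cfgMul (σ τ : Fin n → Bool) : cfgMul σ (cfgMul σ τ) = τ := by
  funext i
  cases h : σ i <;> cases h' : τ i <;> simp [cfgMul, h, h']

lemma sum_cfgMul (σ : Fin n → Bool) (f : (Fin n → Bool) → ℝ) :
    ∑ τ, f (cfgMul σ τ) = ∑ τ, f τ :=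
  Equiv.sum_comp (Function.Involutive.toPerm (cfgMul σ) (cfgMul_cfgMul σ)) f

/-- Multiplicative functions of the spin configuration. -/
def IsSpinChar (χ : (Fin n → Bool) → ℝ) : Prop := ∀ σ τ, χ (cfgMul σ τ) = χ σ * χ τ

lemma IsSpinChar.mul {χ ψ : (Fin n → Bool) → ℝ} (hχ : IsSpinChar χ) (hψ : IsSpinChar ψ) :
    IsSpinChar (χ * ψ) := fun σ τ => by
  simp only [Pi.mul_apply, hχ σ τ, hψ σ τ]
  ring

lemma IsSpinChar.sum_nonneg {χ : (Fin n → Bool) → ℝ} (hχ : IsSpinChar χ) :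
    0 ≤ ∑ σ, χ σ := by
  by_cases h : ∀ σ, χ σ = 1
  · exact Finset.sum_nonneg fun σ _ => by simp [h σ]
  · push Not at h
    obtain ⟨σ, hσ⟩ := h
    have h1 : ∑ τ, χ τ = χ σ * ∑ τ, χ τ := by
      rw [Finset.mul_sum, ← sum_cfgMul σ]
      exact Finset.sum_congr rfl fun τ _ => hχ σ τ
    have h2 : (χ σ - 1) * ∑ τ, χ τ = 0 := by linarith
    rcases mul_eq_zero.1 h2 with h3 | h3
    · exact absurd (by linarith) hσ
    · exact h3.ge

/-- The product of spins `σ ↦ ∏ₗ σ_{e l}`. -/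
def bond {p : ℕ} (e : Fin p → Fin n) (σ : Fin n → Bool) : ℝ := ∏ l, spin (σ (e l))

lemma spin_beq (a b : Bool) : spin (a == b) = spin a * spin b := by
  cases a <;> cases b <;> simp [spin]

lemma isSpinChar_bond {p : ℕ} (e : Fin p → Fin n) : IsSpinChar (bond e) := fun σ τ => by
  simp only [bond, ← Finset.prod_mul_distrib, cfgMul, spin_beq]

lemma bond_eq_or {p : ℕ} (e : Fin p → Fin n) (σ : Fin n → Bool) :
    bond e σ = 1 ∨ bond e σ = -1 := by
  have h : |bond e σ| = 1 := by
    rw [bond, Finset.abs_prod]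
    refine Finset.prod_eq_one fun l _ => ?_
    cases σ (e l) <;> simp [spin]
  exact eq_or_eq_neg_of_abs_eq h

/-- Functions with nonnegative correlation with every spin character. -/
def Ferro (g : (Fin n → Bool) → ℝ) : Prop := ∀ χ, IsSpinChar χ → 0 ≤ ∑ σ, g σ * χ σ

lemma Ferro.mul_affine {g χ : (Fin n → Bool) → ℝ} (hg : Ferro g) (hχ : IsSpinChar χ) {a b : ℝ}
    (ha : 0 ≤ a) (hb : 0 ≤ b) : Ferro fun σ => g σ * (a + b * χ σ) := fun ψ hψ => by
  have h : ∑ σ, g σ * (a + b * χ σ) * ψ σ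
      = a * ∑ σ, g σ * ψ σ + b * ∑ σ, g σ * (χ * ψ) σ := by
    rw [Finset.mul_sum, Finset.mul_sum, ← Finset.sum_add_distrib]
    exact Finset.sum_congr rfl fun σ _ => by simp only [Pi.mul_apply]; ring
  rw [h]
  exact add_nonneg (mul_nonneg ha (hg ψ hψ)) (mul_nonneg hb (hg _ (hχ.mul hψ)))

lemma exp_mul_sign (J : ℝ) {s : ℝ} (hs : s = 1 ∨ s = -1) :
    Real.exp (J * s) = Real.cosh J + Real.sinh J * s := by
  rcases hs with rfl | rfl
  · simp [Real.cosh_add_sinh]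
  · simp [← sub_eq_add_neg, Real.cosh_sub_sinh]

lemma Ferro.mul_exp_bond {p : ℕ} {g : (Fin n → Bool) → ℝ} (hg : Ferro g) {J : ℝ} (hJ : 0 ≤ J)
    (e : Fin p → Fin n) : Ferro fun σ => g σ * Real.exp (J * bond e σ) := by
  simp only [fun σ => exp_mul_sign J (bond_eq_or e σ)]
  exact hg.mul_affine (isSpinChar_bond e) (Real.cosh_pos J).le (Real.sinh_nonneg_iff.2 hJ)

lemma ferro_exp_sum {p k : ℕ} (J : Fin k → ℝ) (hJ : ∀ ν, 0 ≤ J ν) (x : Fin k → Fin p → Fin n) :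
    Ferro fun σ => Real.exp (∑ ν, J ν * bond (x ν) σ) := by
  induction k with
  | zero => intro χ hχ; simpa using hχ.sum_nonneg
  | succ k ih =>
    simp only [Fin.sum_univ_castSucc, Real.exp_add]
    exact (ih _ (fun _ => hJ _) _).mul_exp_bond (hJ _) _

/-- Logarithm of the partition function with negative energy `u`. -/
noncomputable def logPart (β : ℝ) (u : (Fin n → Bool) → ℝ) : ℝ :=
  Real.log (∑ σ, Real.exp (β * u σ))

lemma sum_exp_pos (f : (Fin n → Bool) → ℝ) : 0 < ∑ σ, Real.exp (f σ) :=
  Finset.sum_pos (fun _ _ => Real.exp_pos _) Finset.univ_nonempty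

/-- Griffiths' second inequality, as supermodularity of the log-partition function. -/
lemma logPart_add_le {p k : ℕ} {β : ℝ} (hβ : 0 ≤ β) (x : Fin k → Fin p → Fin n)
    (e e' : Fin p → Fin n) :
    logPart β (∑ ν, bond (x ν) + bond e) + logPart β (∑ ν, bond (x ν) + bond e') ≤
      logPart β (∑ ν, bond (x ν) + bond e + bond e') + logPart β (∑ ν, bond (x ν)) := by
  unfold logPart
  rw [← Real.log_mul (sum_exp_pos _).ne' (sum_exp_pos _).ne',
    ← Real.log_mul (sum_exp_pos _).ne' (sum_exp_pos _).ne']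
  refine Real.log_le_log (mul_pos (sum_exp_pos _) (sum_exp_pos _)) ?_
  rw [← sub_nonneg, Finset.sum_mul_sum, Finset.sum_mul_sum, ← Finset.sum_sub_distrib]
  simp only [← Finset.sum_sub_distrib]
  simp_rw [fun σ => (sum_cfgMul σ fun τ => Real.exp (β * (∑ ν, bond (x ν) + bond e + bond e') σ) *
    Real.exp (β * (∑ ν, bond (x ν)) τ) - Real.exp (β * (∑ ν, bond (x ν) + bond e) σ) *
    Real.exp (β * (∑ ν, bond (x ν) + bond e') τ)).symm]
  rw [Finset.sum_comm]
  refine Finset.sum_nonneg fun τ _ => ?_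
  have hb : ∀ ν, 0 ≤ β * (1 + bond (x ν) τ) := fun ν => mul_nonneg hβ (by
    rcases bond_eq_or (x ν) τ with h | h <;> rw [h] <;> norm_num)
  have key := (ferro_exp_sum _ hb x).mul_exp_bond hβ e
  have hfac : ∀ σ, Real.exp (β * (∑ ν, bond (x ν) + bond e + bond e') σ) *
      Real.exp (β * (∑ ν, bond (x ν)) (cfgMul σ τ)) -
      Real.exp (β * (∑ ν, bond (x ν) + bond e) σ) *
      Real.exp (β * (∑ ν, bond (x ν) + bond e') (cfgMul σ τ)) =
      Real.exp (∑ ν, β * (1 + bond (x ν) τ) * bond (x ν) σ) * Real.exp (β * bond e σ) *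
        (Real.exp (β * bond e' σ) - Real.exp (β * bond e' τ * bond e' σ)) := fun σ => by
    have h : ∑ ν, β * (1 + bond (x ν) τ) * bond (x ν) σ =
        β * ∑ ν, bond (x ν) σ + β * ∑ ν, bond (x ν) σ * bond (x ν) τ := by
      rw [← mul_add, ← Finset.sum_add_distrib, Finset.mul_sum]
      exact Finset.sum_congr rfl fun ν _ => by ring
    simp only [Pi.add_apply, Finset.sum_apply, isSpinChar_bond _ σ τ, h, mul_sub,
      ← Real.exp_add]
    congr 2 <;> ring
  simp only [hfac]
  rcases bond_eq_or e' τ with h | h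
  · simp [h]
  · have := mul_nonneg (mul_nonneg zero_le_two (Real.sinh_nonneg_iff.2 hβ))
      (key _ (isSpinChar_bond e'))
    refine this.trans_eq ?_
    rw [Finset.mul_sum]
    refine Finset.sum_congr rfl fun σ _ => ?_
    rw [h, exp_mul_sign β (bond_eq_or e' σ), exp_mul_sign (β * -1) (bond_eq_or e' σ),
      mul_neg_one, Real.cosh_neg, Real.sinh_neg]
    ring

lemma norm_bond_le {p : ℕ} (e : Fin p → Fin n) : ‖bond e‖ ≤ 1 :=
  (pi_norm_le_iff_of_nonneg zero_le_one).2 fun σ => by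
    rcases bond_eq_or e σ with h | h <;> simp [h]

lemma expGrowth_logPart {β : ℝ} (hβ : 0 ≤ β) :
    ExpGrowth (Real.log (Fintype.card (Fin n → Bool)) + β) (logPart (n := n) β) := fun u => by
  have hc : (1 : ℝ) ≤ Fintype.card (Fin n → Bool) := by exact_mod_cast Fintype.card_pos
  have hu : ∀ σ, |β * u σ| ≤ β * ‖u‖ := fun σ => by
    rw [abs_mul, abs_of_nonneg hβ]
    exact mul_le_mul_of_nonneg_left (norm_le_pi_norm u σ) hβ
  have hlow : -(β * ‖u‖) ≤ logPart β u := by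
    refine (abs_le.1 (hu default)).1.trans ((Real.le_log_iff_exp_le (sum_exp_pos _)).2 ?_)
    exact Finset.single_le_sum (f := fun σ => Real.exp (β * u σ))
      (fun _ _ => (Real.exp_pos _).le) (Finset.mem_univ _)
  have hup : logPart β u ≤ Real.log (Fintype.card (Fin n → Bool)) + β * ‖u‖ := by
    rw [← Real.log_exp (β * ‖u‖), ← Real.log_mul (by positivity) (Real.exp_pos _).ne']
    refine Real.log_le_log (sum_exp_pos _) ?_
    calc ∑ σ, Real.exp (β * u σ) ≤ ∑ _σ : Fin n → Bool, Real.exp (β * ‖u‖) :=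
          Finset.sum_le_sum fun σ _ => Real.exp_le_exp.2 (abs_le.1 (hu σ)).2
      _ = _ := by simp
  have hlog := Real.log_nonneg hc
  have h1 := Real.add_one_le_exp ‖u‖
  have h2 := norm_nonneg u
  rw [abs_le]
  constructor <;> nlinarith

end Griffiths

section Convexity

lemma hasDerivAt_poisson_tsum {a : ℕ → ℝ} {C D : ℝ} (ha : ∀ k, |a k| ≤ C * D ^ k)
    (t : ℝ) :
    HasDerivAt (fun s => ∑' k, pois s k * a k) (∑' k, pois t k * (a (k + 1) - a k)) t := by
  have hC : 0 ≤ C := by simpa using (abs_nonneg _).trans (ha 0)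
  have hsum : ∀ (b : ℕ → ℝ) (B : ℝ), (∀ k, |b k| ≤ B * D ^ k) → ∀ s : ℝ,
      Summable fun k => b k * s ^ k / k.factorial := fun b B hb s => by
    refine Summable.of_norm_bounded
      ((Real.summable_pow_div_factorial (D * |s|)).mul_left B) fun k => ?_
    rw [norm_div, norm_mul, norm_pow, Real.norm_eq_abs, Real.norm_eq_abs, Real.norm_natCast,
      mul_pow, ← mul_div_assoc, ← mul_assoc]
    gcongr
    exact hb k
  have ha' : ∀ k, |a (k + 1)| ≤ C * D * D ^ k := fun k => by
    rw [mul_assoc, ← pow_succ']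
    exact ha (k + 1)
  set R := |t| + 1
  have hR : 0 ≤ R := by positivity
  have hder : HasDerivAt (fun s => ∑' k, a k * s ^ k / k.factorial)
      (∑' k, a k * (k * t ^ (k - 1)) / k.factorial) t := by
    refine hasDerivAt_tsum_of_isPreconnected (t := Metric.ball (0 : ℝ) R)
      (g := fun k s => a k * s ^ k / k.factorial)
      (g' := fun k s => a k * (k * s ^ (k - 1)) / k.factorial) (y := t)
      (u := fun k => |a k| * (k * R ^ (k - 1)) / k.factorial) (y₀ := t) ?_ Metric.isOpen_ball
      (convex_ball _ _).isPreconnected (fun k s _ => ?_) (fun k s hs => ?_) ?_ ?_ ?_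
    · rw [← summable_nat_add_iff 1]
      refine (hsum (fun k => |a (k + 1)|) (C * D) (fun k => by rw [abs_abs]; exact ha' k)
        R).congr fun k => ?_
      rw [Nat.factorial_succ, Nat.add_sub_cancel]
      push_cast
      field_simp
    · exact ((hasDerivAt_pow k s).const_mul (a k)).div_const _
    · have hs' : |s| ≤ R := (mem_ball_zero_iff.1 hs).le
      rw [norm_div, norm_mul, norm_mul, norm_pow, Real.norm_natCast, Real.norm_natCast,
        Real.norm_eq_abs, Real.norm_eq_abs]
      gcongr
    · simp [R]
    · exact hsum a C ha t
    · simp [R]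
  have hshift : ∑' k, a k * (k * t ^ (k - 1)) / k.factorial =
      ∑' k, a (k + 1) * t ^ k / k.factorial := by
    rw [tsum_eq_zero_add']
    · simp only [Nat.cast_zero, zero_mul, mul_zero, zero_div, zero_add]
      refine tsum_congr fun k => ?_
      rw [Nat.factorial_succ, Nat.add_sub_cancel]
      push_cast
      field_simp
    · refine (hsum (fun k => a (k + 1)) (C * D) ha' t).congr fun k => ?_
      rw [Nat.factorial_succ, Nat.add_sub_cancel]
      push_cast
      field_simp
  rw [hshift] at hder
  have h := ((hasDerivAt_id t).neg.exp).mul hder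
  have hfun : (fun s => ∑' k, pois s k * a k) =
      (fun s => Real.exp (-id s)) * fun s => ∑' k, a k * s ^ k / k.factorial := by
    funext s
    rw [Pi.mul_apply, ← tsum_mul_left]
    exact tsum_congr fun k => by simp only [pois, id]; ring
  have hval : ∑' k, pois t k * (a (k + 1) - a k) =
      Real.exp ((-id) t) * -1 * ∑' k, a k * t ^ k / k.factorial +
        Real.exp ((-id) t) * ∑' k, a (k + 1) * t ^ k / k.factorial := by
    rw [mul_assoc, ← mul_add, neg_one_mul, neg_add_eq_sub,
      ← (hsum _ _ ha' t).tsum_sub (hsum a C ha t), ← tsum_mul_left]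
    exact tsum_congr fun k => by simp only [pois, Pi.neg_apply, id]; ring
  rw [hfun, hval]
  exact h

/-- A Poisson average is convex in the Poisson mean when the second differences are
nonnegative. -/
lemma convexOn_poisson_tsum {a : ℕ → ℝ} {C D : ℝ} (ha : ∀ k, |a k| ≤ C * D ^ k)
    (h2 : ∀ k, 0 ≤ a (k + 2) - a (k + 1) - (a (k + 1) - a k)) :
    ConvexOn ℝ (Set.Ici 0) fun s => ∑' k, pois s k * a k := by
  have hb : ∀ k, |a (k + 1) - a k| ≤ (C * D + C) * D ^ k := fun k => by
    refine (abs_sub _ _).trans ((add_le_add (ha (k + 1)) (ha k)).trans_eq ?_)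
    ring
  have hd1 := hasDerivAt_poisson_tsum ha
  have hd2 := hasDerivAt_poisson_tsum hb
  refine convexOn_of_hasDerivWithinAt2_nonneg (convex_Ici 0)
    (fun t _ => (hd1 t).continuousAt.continuousWithinAt)
    (fun t _ => (hd1 t).hasDerivWithinAt) (fun t _ => (hd2 t).hasDerivWithinAt)
    fun t ht => tsum_nonneg fun k => mul_nonneg ?_ (h2 k)
  rw [interior_Ici] at ht
  have : 0 < t := ht
  unfold pois
  positivity

end Convexity

section Pressure

lemma avgIdx_eq_pow {V : Type*} [NormedAddCommGroup V] (N p k : ℕ) (v : (Fin p → Fin N) → V)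
    (G : V → ℝ) (u : V) :
    avgIdx N p k (fun im => G (u + ∑ ν, v fun l => im l ν)) =
      ((((N : ℝ) ^ p)⁻¹ • jump v) ^ k) G u := by
  rw [smul_jump_pow_apply, avgIdx, inv_pow, pow_mul]
  congr 1
  exact (Equiv.piComm fun (_ : Fin p) (_ : Fin k) => Fin N).sum_comp
    fun x => G (u + ∑ ν, v (x ν))

lemma tsum_pois_avgIdx {V : Type*} [NormedAddCommGroup V] {N p : ℕ} (hN : N ≠ 0)
    (v : (Fin p → Fin N) → V) (G : V → ℝ) (u : V) {m c : ℝ} (hm : m = c * N ^ p) :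
    ∑' k, pois m k * avgIdx N p k (fun im => G (u + ∑ ν, v fun l => im l ν)) =
      poissonMean m (c • jump v) G u := by
  refine tsum_congr fun k => ?_
  have hN' : (N : ℝ) ≠ 0 := Nat.cast_ne_zero.2 hN
  rw [avgIdx_eq_pow, smul_jump_pow_apply, smul_jump_pow_apply, pois, hm, mul_pow, inv_pow]
  have hpow : ((N : ℝ) ^ p) ^ k ≠ 0 := pow_ne_zero _ (pow_ne_zero _ hN')
  field_simp

lemma Zpart_eq (β : ℝ) {N p k : ℕ} (im : Fin p → Fin k → Fin N) :
    Real.log (Zpart β im) = logPart β (∑ ν, bond fun l => im l ν) := by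
  simp [Zpart, logPart, intSum, bond, Finset.sum_apply]

lemma ElnZ_eq_tsum (N : ℕ) (γ β : ℝ) :
    ElnZ N 2 γ β = ∑' k, pois (γ * N) k *
      ((((N : ℝ) ^ 2)⁻¹ • jump (bond (p := 2) (n := N))) ^ k) (logPart β) 0 := by
  refine tsum_congr fun k => ?_
  rw [← avgIdx_eq_pow]
  simp only [Zpart_eq, zero_add]

lemma ElnZ_eq_poissonMean {N : ℕ} (hN : N ≠ 0) {γ c : ℝ} (hc : γ * N = c * N ^ 2) (β : ℝ) :
    ElnZ N 2 γ β =
      poissonMean (γ * N) (c • jump (bond (p := 2) (n := N))) (logPart β) 0 := by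
  rw [← tsum_pois_avgIdx hN _ _ _ hc]
  simp only [zero_add, ElnZ, Equench, Zpart_eq]

lemma convexOn_pressure {N : ℕ} (hN : N ≠ 0) {β : ℝ} (hβ : 0 ≤ β) :
    ConvexOn ℝ (Set.Ici 0) fun a => pressure N 2 a β := by
  set c : ℝ := ((N : ℝ) ^ 2)⁻¹ with hcdef
  have hc : 0 ≤ c := by positivity
  set M : Module.End ℝ (((Fin N → Bool) → ℝ) → ℝ) := c • jump (bond (p := 2) (n := N)) with hM
  set F : ((Fin N → Bool) → ℝ) → ℝ := logPart β with hF
  have hN' : (N : ℝ) ≠ 0 := Nat.cast_ne_zero.2 hN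
  have hbound : ∀ k, |(M ^ k) F 0| ≤ (Real.log (Fintype.card (Fin N → Bool)) + β) *
      (|c| * (Fintype.card (Fin 2 → Fin N) * Real.exp 1)) ^ k := fun k => by
    refine ((ExpBounded.smul_jump c norm_bond_le).pow k _ F (expGrowth_logPart hβ) 0).trans_eq ?_
    rw [norm_zero, Real.exp_zero, mul_one, mul_comm]
  have hMapply : ∀ (G : ((Fin N → Bool) → ℝ) → ℝ) u, M G u = c * ∑ e, G (u + bond e) :=
    fun G u => by rw [hM, LinearMap.smul_apply, Pi.smul_apply, jump_apply, smul_eq_mul]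
  have hmean : ∀ r : ℝ, r = c * ∑ _e : Fin 2 → Fin N, r := fun r => by
    simp only [Finset.sum_const, Finset.card_univ, Fintype.card_fun, Fintype.card_fin,
      nsmul_eq_mul, hcdef]
    push_cast
    field_simp
  have hdiff2 : ∀ k, 0 ≤ (M ^ (k + 2)) F 0 - (M ^ (k + 1)) F 0 -
      ((M ^ (k + 1)) F 0 - (M ^ k) F 0) := fun k => by
    have h1 : (M ^ (k + 2)) F 0 - (M ^ (k + 1)) F 0 - ((M ^ (k + 1)) F 0 - (M ^ k) F 0) =
        (M ^ k) (M (M F) - M F - (M F - F)) 0 := by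
      simp only [map_sub, pow_succ, Module.End.mul_apply, Pi.sub_apply]
    rw [h1, hM, smul_jump_pow_apply, ← hM]
    refine mul_nonneg (pow_nonneg hc k) (Finset.sum_nonneg fun x _ => ?_)
    rw [zero_add]
    set u := ∑ ν, bond (x ν) with hu
    have h2 : (M (M F) - M F - (M F - F)) u = c * ∑ e : Fin 2 → Fin N, c * ∑ e' : Fin 2 → Fin N,
        (F (u + bond e + bond e') - F (u + bond e) - (F (u + bond e') - F u)) := by
      simp only [Finset.sum_sub_distrib, mul_sub, ← hmean, Pi.sub_apply, hMapply]
    rw [h2]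
    refine mul_nonneg hc (Finset.sum_nonneg fun e _ => mul_nonneg hc
      (Finset.sum_nonneg fun e' _ => ?_))
    have := logPart_add_le hβ x e e'
    rw [← hu, ← hF] at this
    linarith
  have hconv := convexOn_poisson_tsum hbound hdiff2
  have hcomp := (hconv.comp_linearMap (LinearMap.mulRight ℝ (N : ℝ))).smul
    (inv_nonneg.2 (Nat.cast_nonneg (α := ℝ) N))
  refine (hcomp.subset (fun a ha => ?_) (convex_Ici 0)).congr fun a _ => ?_
  · have ha' : (0 : ℝ) ≤ a := ha
    change (0 : ℝ) ≤ a * N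
    exact mul_nonneg ha' (Nat.cast_nonneg N)
  · simp only [pressure, ElnZ_eq_tsum]
    rfl

end Pressure

section Cavity

variable {N : ℕ}

/-- A bond between two old spins, seen in the system with one more spin. -/
def innerBond (e : Fin 2 → Fin N) : (Fin (N + 1) → Bool) → ℝ := bond fun l => (e l).castSucc

/-- A bond between an old spin and the new spin. -/
def starBond (e : Fin 1 → Fin N) : (Fin (N + 1) → Bool) → ℝ :=
  bond ![(e 0).castSucc, Fin.last N]

/-- The bond of the new spin with itself. -/
def loopBond (_ : Unit) : (Fin (N + 1) → Bool) → ℝ := bond ![Fin.last N, Fin.last N]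

lemma loopBond_eq_one : loopBond (N := N) () = 1 := by
  funext σ
  cases h : σ (Fin.last N) <;> simp [loopBond, bond, spin, h]

lemma jump_bond_succ : jump (bond (p := 2) (n := N + 1)) =
    jump (innerBond (N := N)) + ((2 : ℝ) • jump (starBond (N := N)) + jump (loopBond (N := N))) := by
  refine LinearMap.ext fun F => funext fun u => ?_
  have hswap : ∀ i j : Fin (N + 1), bond ![i, j] = bond ![j, i] := fun i j => by
    funext σ
    simp [bond, mul_comm]
  have hinner : ∀ i j : Fin N, innerBond ![i, j] = bond ![i.castSucc, j.castSucc] := fun i j => by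
    funext σ
    simp [bond, innerBond]
  simp only [LinearMap.add_apply, LinearMap.smul_apply, Pi.add_apply, Pi.smul_apply, jump_apply,
    smul_eq_mul]
  rw [← (finTwoArrowEquiv (Fin (N + 1))).symm.sum_comp,
    ← (finTwoArrowEquiv (Fin N)).symm.sum_comp, ← (Equiv.funUnique (Fin 1) (Fin N)).symm.sum_comp,
    Fintype.sum_prod_type, Fintype.sum_prod_type]
  simp only [finTwoArrowEquiv_symm_apply, Fin.sum_univ_castSucc, Finset.sum_add_distrib, hinner,
    Finset.univ_unique, Finset.sum_singleton, loopBond, starBond, hswap (Fin.last N)]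
  simp [two_mul, add_assoc]

/-- The gauge transformation `σᵢ ↦ σᵢ σ_{N+1}` decouples the new spin. -/
lemma logPart_inner_add_star (β : ℝ) {k k' : ℕ} (im : Fin 2 → Fin k → Fin N)
    (im' : Fin 1 → Fin k' → Fin N) :
    logPart β (∑ ν, innerBond (fun l => im l ν) + ∑ ν, starBond fun l => im' l ν) =
      Real.log 2 + Real.log (Zpert β im im') := by
  have hpos : 0 < Zpert β im im' := sum_exp_pos _
  rw [← Real.log_mul two_ne_zero hpos.ne', logPart]
  congr 1
  have hin : ∀ (e : Fin 2 → Fin N) (b : Bool) (σ : Fin N → Bool),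
      innerBond e (Fin.snoc σ b : Fin (N + 1) → Bool) = bond e σ := fun e b σ => by
    simp [innerBond, bond]
  have hst : ∀ (e : Fin 1 → Fin N) (b : Bool) (σ : Fin N → Bool),
      starBond e (Fin.snoc σ b : Fin (N + 1) → Bool) = bond e σ * spin b := fun e b σ => by
    simp [starBond, bond]
  rw [← (Fin.snocEquiv fun _ : Fin (N + 1) => Bool).sum_comp, Fintype.sum_prod_type,
    Fintype.sum_bool, two_mul]
  congr 1
  · simp [Fin.snocEquiv, hin, hst, Zpert, wpert, intSum, cavSum, bond, spin]
  · rw [Zpert]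
    refine Eq.trans ?_ (sum_cfgMul (fun _ => false) (wpert β im im'))
    have h2 : ∀ e : Fin 2 → Fin N, bond e (fun _ => false) = 1 := fun e => by simp [bond, spin]
    have h1 : ∀ e : Fin 1 → Fin N, bond e (fun _ => false) = -1 := fun e => by simp [bond, spin]
    refine Finset.sum_congr rfl fun σ _ => ?_
    have hI : intSum im (cfgMul (fun _ => false) σ) = ∑ ν, bond (fun l => im l ν) σ :=
      Finset.sum_congr rfl fun ν _ => by
        change bond (fun l => im l ν) _ = _
        rw [isSpinChar_bond, h2, one_mul]
    have hC : cavSum im' (cfgMul (fun _ => false) σ) = ∑ ν, bond (fun l => im' l ν) σ * -1 :=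
      Finset.sum_congr rfl fun ν _ => by
        change bond (fun l => im' l ν) _ = _
        rw [isSpinChar_bond, h1, mul_comm]
    simp [wpert, hI, hC, Fin.snocEquiv, hin, hst, spin]

lemma logPart_inner (β : ℝ) {k : ℕ} (im : Fin 2 → Fin k → Fin N) :
    logPart β (∑ ν, innerBond fun l => im l ν) = Real.log 2 + Real.log (Zpart β im) := by
  have h := logPart_inner_add_star β im (fun _ => Fin.elim0 : Fin 1 → Fin 0 → Fin N)
  simpa [Zpert, wpert, cavSum, Zpart] using h

lemma poissonMean_loop (β c : ℝ) :
    poissonMean c (c • jump (loopBond (N := N))) (logPart β) = logPart β + fun _ => β * c := by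
  funext u
  have hshift : ∀ k : ℕ, logPart β (u + (k : (Fin (N + 1) → Bool) → ℝ)) = logPart β u + β * k :=
    fun k => by
      have hpos := sum_exp_pos fun σ => β * u σ
      simp only [logPart, Pi.add_apply, Pi.natCast_apply, mul_add, Real.exp_add]
      rw [← Finset.sum_mul, Real.log_mul hpos.ne' (Real.exp_pos _).ne', Real.log_exp]
  have h := ((hasSum_poisson c).mul_right (logPart β u)).add
    ((hasSum_poisson_mean c).mul_left β)
  rw [one_mul] at h
  refine (tsum_congr fun k => ?_).trans h.tsum_eq
  rw [smul_jump_pow_apply]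
  simp [loopBond_eq_one, hshift]
  ring

/-- Adding one spin: the exact cavity identity. -/
lemma ElnZ_succ (hN : N ≠ 0) {β : ℝ} (hβ : 0 ≤ β) (α : ℝ) :
    ElnZ (N + 1) 2 α β = ElnZ N 2 (N * α / (N + 1)) β + cavityFn N 2 (N * α / (N + 1)) β 1 +
      Real.log 2 + β * (α / (N + 1)) := by
  have hN1 : (N : ℝ) + 1 ≠ 0 := by positivity
  set γ : ℝ := N * α / (N + 1) with hγ
  set c : ℝ := α / (N + 1) with hc
  set F : ((Fin (N + 1) → Bool) → ℝ) → ℝ := logPart β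
  have hF := expGrowth_logPart (n := N + 1) hβ
  have hvin : ∀ e : Fin 2 → Fin N, ‖innerBond e‖ ≤ 1 := fun e => norm_bond_le _
  have hvst : ∀ e : Fin 1 → Fin N, ‖starBond e‖ ≤ 1 := fun e => norm_bond_le _
  have hvlo : ∀ e : Unit, ‖loopBond (N := N) e‖ ≤ 1 := fun e => norm_bond_le _
  have hIn := ExpBounded.smul_jump c hvin
  have hSt := ExpBounded.smul_jump (2 * c) hvst
  have hLo := ExpBounded.smul_jump c hvlo
  set In := c • jump (innerBond (N := N))
  set St := (2 * c) • jump (starBond (N := N))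
  set Lo := c • jump (loopBond (N := N))
  have hmIn : γ * N = c * N ^ 2 := by rw [hγ, hc]; ring
  have hmSt : 2 * γ * 1 = 2 * c * N ^ 1 := by rw [hγ, hc]; ring
  have hconstIn : ∀ (d : ℝ) u, poissonMean (γ * N) In (fun _ => d) u = d := fun d u => by
    rw [hmIn]
    simpa using poissonMean_const c d (innerBond (N := N)) u
  have hconstSt : ∀ (d : ℝ) u, poissonMean (2 * γ * 1) St (fun _ => d) u = d := fun d u => by
    rw [hmSt]
    simpa using poissonMean_const (2 * c) d (starBond (N := N)) u
  set P := poissonMean (2 * γ * 1) St F with hP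
  have hPg := hSt.poissonMean hF (2 * γ * 1)
  rw [← hP] at hPg
  have hsucc : ElnZ (N + 1) 2 α β = poissonMean (γ * N) In P 0 + β * c := by
    rw [ElnZ_eq_poissonMean N.succ_ne_zero (c := c) (by rw [hc]; push_cast; field_simp),
      jump_bond_succ]
    have hop : c • (jump (innerBond (N := N)) +
        ((2 : ℝ) • jump (starBond (N := N)) + jump (loopBond (N := N)))) = In + (St + Lo) := by
      rw [smul_add, smul_add, smul_smul, mul_comm c 2]
    have hm : α * ((N + 1 : ℕ) : ℝ) = γ * N + (2 * γ * 1 + c) := by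
      rw [hγ, hc]; push_cast; field_simp; ring
    have hcomm : Commute St Lo := ((jump_commute _ _).smul_left _).smul_right _
    have hcomm' : Commute In (St + Lo) :=
      (((jump_commute _ _).smul_left _).smul_right _).add_right
        (((jump_commute _ _).smul_left _).smul_right _)
    rw [hop, hm, poissonMean_split hvin (hSt.add hLo) hF hcomm']
    have hinner : poissonMean (2 * γ * 1 + c) (St + Lo) F = P + fun _ => β * c := funext fun u => by
      rw [poissonMean_split hvst hLo hF hcomm, poissonMean_loop,
        poissonMean_add hSt hF (ExpGrowth.const _), hconstSt]
      rfl
    rw [hinner, poissonMean_add hIn hPg (ExpGrowth.const _), hconstIn]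
  have hElnZ : ElnZ N 2 γ β = poissonMean (γ * N) In F 0 - Real.log 2 := by
    have h := tsum_pois_avgIdx hN (innerBond (N := N)) (F + fun _ => -Real.log 2) 0 hmIn
    rw [poissonMean_add hIn hF (ExpGrowth.const _), hconstIn, ← sub_eq_add_neg] at h
    rw [← h]
    refine tsum_congr fun k => ?_
    congr 2
    funext im
    rw [zero_add]
    change Real.log (Zpart β im) = logPart β _ + -Real.log 2
    rw [logPart_inner]
    ring
  have hcavity : cavityFn N 2 γ β 1 = poissonMean (γ * N) In P 0 - poissonMean (γ * N) In F 0 := by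
    have h := tsum_pois_avgIdx hN (innerBond (N := N)) (P + (-1 : ℝ) • F) 0 hmIn
    rw [poissonMean_add hIn hPg (hF.smul _), poissonMean_smul, neg_one_mul, ← sub_eq_add_neg] at h
    rw [← h]
    refine tsum_congr fun k => ?_
    congr 2
    funext im
    set u := ∑ ν, innerBond (fun l => im l ν) with hu
    have h' := tsum_pois_avgIdx hN (starBond (N := N)) (F + fun _ => -F u) u hmSt
    rw [poissonMean_add hSt hF (ExpGrowth.const _), hconstSt, ← hP] at h'
    rw [zero_add, Pi.add_apply, Pi.smul_apply, smul_eq_mul, neg_one_mul, ← h']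
    refine tsum_congr fun k' => ?_
    congr 2
    funext im'
    have hpos : 0 < Zpart β im := sum_exp_pos _
    have hpos' : 0 < Zpert β im im' := sum_exp_pos _
    change Real.log (Zpert β im im' / Zpart β im) =
      logPart β (u + ∑ ν, starBond fun l => im' l ν) + -logPart β u
    have h₁ := logPart_inner β im
    have h₂ := logPart_inner_add_star β im im'
    rw [← hu] at h₁ h₂
    rw [Real.log_div hpos'.ne' hpos.ne']
    linarith
  rw [hsucc, hElnZ, hcavity]
  ring

end Cavity

section Limit

open Topology

/-- Slopes of converging convex functions converge to the derivative of a differentiable limit. -/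
lemma tendsto_slope_of_convexOn {f : ℕ → ℝ → ℝ} {g : ℝ → ℝ} {s : Set ℝ} {a d : ℝ}
    (hs : s ∈ 𝓝 a) (hf : ∀ᶠ n in atTop, ConvexOn ℝ s (f n))
    (hlim : ∀ᶠ b in 𝓝 a, Tendsto (fun n => f n b) atTop (𝓝 (g b))) (hg : HasDerivAt g d a)
    {x : ℕ → ℝ} (hx : Tendsto x atTop (𝓝[≠] a)) :
    Tendsto (fun n => slope (f n) a (x n)) atTop (𝓝 d) := by
  have hslope := hasDerivAt_iff_tendsto_slope.1 hg
  have hx' : Tendsto x atTop (𝓝 a) := hx.mono_right nhdsWithin_le_nhds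
  have hlimslope : ∀ b, Tendsto (fun n => f n b) atTop (𝓝 (g b)) →
      Tendsto (fun n => slope (f n) a b) atTop (𝓝 (slope g a b)) := fun b hb => by
    simp only [slope_def_field]
    exact (hb.sub hlim.self_of_nhds).div_const _
  have hxs : ∀ᶠ n in atTop, x n ∈ s \ {a} :=
    (hx'.eventually hs).and (hx.eventually self_mem_nhdsWithin)
  refine tendsto_order.2 ⟨fun y hy => ?_, fun y hy => ?_⟩
  · have hsw : ∀ᶠ b in 𝓝[<] a, b ∈ s := nhdsWithin_le_nhds hs
    have hev : ∀ᶠ b in 𝓝[<] a, y < slope g a b :=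
      (hslope.mono_left (nhdsWithin_mono a fun b hb => (ne_of_lt hb : b ≠ a))).eventually
        (lt_mem_nhds hy)
    obtain ⟨b, hyb, hb, hbs, hba⟩ := (hev.and ((hlim.filter_mono nhdsWithin_le_nhds).and
      (hsw.and self_mem_nhdsWithin))).exists
    filter_upwards [hf, hxs, hx'.eventually (lt_mem_nhds (hba : b < a)),
      (hlimslope b hb).eventually (lt_mem_nhds hyb)] with n hn hxn hbx hyn
    exact hyn.trans_le (hn.slope_mono (mem_of_mem_nhds hs) ⟨hbs, ne_of_lt hba⟩ hxn hbx.le)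
  · have hsw : ∀ᶠ b in 𝓝[>] a, b ∈ s := nhdsWithin_le_nhds hs
    have hev : ∀ᶠ b in 𝓝[>] a, slope g a b < y :=
      (hslope.mono_left (nhdsWithin_mono a fun b hb => (ne_of_gt hb : b ≠ a))).eventually
        (gt_mem_nhds hy)
    obtain ⟨b, hyb, hb, hbs, hba⟩ := (hev.and ((hlim.filter_mono nhdsWithin_le_nhds).and
      (hsw.and self_mem_nhdsWithin))).exists
    filter_upwards [hf, hxs, hx'.eventually (gt_mem_nhds (hba : a < b)),
      (hlimslope b hb).eventually (gt_mem_nhds hyb)] with n hn hxn hbx hyn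
    exact (hn.slope_mono (mem_of_mem_nhds hs) hxn ⟨hbs, ne_of_gt hba⟩ hbx.le).trans_lt hyn

/-- Cesàro: a sequence whose extensive version has converging increments has the same limit. -/
lemma eq_of_tendsto_increment {p : ℕ → ℝ} {l m : ℝ} (hp : Tendsto p atTop (𝓝 l))
    (hinc : Tendsto (fun n : ℕ => ((n : ℝ) + 1) * p (n + 1) - n * p n) atTop (𝓝 m)) : l = m := by
  refine tendsto_nhds_unique hp (hinc.cesaro.congr' ?_)
  filter_upwards [eventually_ne_atTop 0] with n hn
  have h := Finset.sum_range_sub (fun n : ℕ => (n : ℝ) * p n) n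
  push_cast at h
  rw [h]
  have : (n : ℝ) ≠ 0 := Nat.cast_ne_zero.2 hn
  field_simp
  ring

lemma mul_pressure {N : ℕ} (hN : N ≠ 0) (α β : ℝ) : N * pressure N 2 α β = ElnZ N 2 α β :=
  mul_inv_cancel_left₀ (Nat.cast_ne_zero.2 hN) _

end Limit

/-- Free-energy representation (Theorem 1 of the paper) for the diluted Curie–Weiss model
(`p = 2`, `γ = α`): assuming (i) the thermodynamic limit `A(α,β)` of the quenched pressure
exists for `α` in an open interval `I ⊆ (0,∞)` and is differentiable there, (ii) the
`α`-derivatives of the finite-volume pressures converge to `∂_α A`, and (iii) the cavity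
functions `Ψ_N(α̃_N,β,1)` (with `α̃_N = Nα/(N+1)`) converge, then
`A(α,β) = ln 2 - α ∂_α A(α,β) + Ψ(α,β,1)` for every `α ∈ I`. -/
theorem free_energy_representation (β : ℝ) (hβ : 0 < β)
    (I : Set ℝ) (hIopen : IsOpen I) (hIpos : I ⊆ Set.Ioi (0 : ℝ))
    (A ΨL : ℝ → ℝ)
    (hlim : ∀ α ∈ I, Tendsto (fun N : ℕ => pressure N 2 α β) atTop (nhds (A α)))
    (hdiff : DifferentiableOn ℝ A I)
    (hderiv : ∀ α ∈ I,
      Tendsto (fun N : ℕ => deriv (fun a : ℝ => pressure N 2 a β) α) atTop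
        (nhds (deriv A α)))
    (hcav : ∀ α ∈ I,
      Tendsto (fun N : ℕ => cavityFn N 2 ((N : ℝ) * α / ((N : ℝ) + 1)) β 1) atTop
        (nhds (ΨL α))) :
    ∀ α ∈ I, A α = Real.log 2 - α * deriv A α + ΨL α := by
  intro α hα
  have hα0 : 0 < α := hIpos hα
  set x : ℕ → ℝ := fun N => (N : ℝ) * α / ((N : ℝ) + 1) with hx
  have hN1 : ∀ N : ℕ, (N : ℝ) + 1 ≠ 0 := fun N => by positivity
  have hxsub : ∀ N, x N - α = -(α * (1 / ((N : ℝ) + 1))) := fun N => by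
    have := hN1 N
    simp only [hx]
    field_simp
    ring
  have hinv : Tendsto (fun N : ℕ => 1 / ((N : ℝ) + 1)) atTop (nhds 0) :=
    tendsto_one_div_add_atTop_nhds_zero_nat
  have hxlim : Tendsto x atTop (nhds α) := by
    have h := ((hinv.const_mul α).neg).const_add α
    rw [mul_zero, neg_zero, add_zero] at h
    exact h.congr fun N => by rw [← hxsub]; ring
  have hxne : ∀ N, x N ≠ α := fun N h => by
    have h' := hxsub N
    have : 0 < α * (1 / ((N : ℝ) + 1)) := by positivity
    linarith
  have hslope := tendsto_slope_of_convexOn (f := fun N a => pressure N 2 a β) (Ici_mem_nhds hα0)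
    ((eventually_ne_atTop 0).mono fun N hN => convexOn_pressure hN hβ.le)
    ((hIopen.eventually_mem hα).mono hlim) (hdiff.hasDerivAt (hIopen.mem_nhds hα))
    (tendsto_nhdsWithin_iff.2 ⟨hxlim, Eventually.of_forall hxne⟩)
  have hL := (((hcav α hα).add_const (Real.log 2)).add ((hinv.const_mul α).const_mul β)).sub
    (hxlim.mul hslope)
  refine (eq_of_tendsto_increment (hlim α hα) (hL.congr' ?_)).trans (by ring)
  filter_upwards [eventually_ne_atTop 0] with N hN
  have h := ElnZ_succ hN hβ.le α
  rw [← mul_pressure hN, ← mul_pressure N.succ_ne_zero] at h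
  push_cast at h
  rw [h, slope_def_field, hxsub]
  have h1 := hN1 N
  simp only [hx]
  field_simp
  ring
end

section
/- For every N ∈ ℕ, α > 0 and β > 0, the quenched pressure is differentiable in β and ∂A_N(α,β)/∂β = αθ − α(1−θ²) ∑_{n=1}^∞ (−1)^n θ^{n−1} ⟨q_{1…n}²⟩_N, where θ = tanh β and the series converges absolutely. -/
open scoped BigOperators

noncomputable section

/-- The product of the spins of `σ` at the sites `x 0, …, x (p - 1)`. -/
def siteProd {N p : ℕ} (x : Fin p → Fin N) (σ : Fin N → Bool) : ℝ :=
  ∏ l, spin (σ (x l))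

/-- The Boltzmann expectation of an observable `g` of a single replica. -/
def boltzmann (β : ℝ) {N p k : ℕ} (im : Fin p → Fin k → Fin N) (g : (Fin N → Bool) → ℝ) : ℝ :=
  (∑ σ, g σ * Real.exp (β * intSum im σ)) / Zpart β im

lemma spin_eq_or (b : Bool) : spin b = 1 ∨ spin b = -1 := by
  cases b <;> simp [spin]

lemma siteProd_eq_or {N p : ℕ} (x : Fin p → Fin N) (σ : Fin N → Bool) :
    siteProd x σ = 1 ∨ siteProd x σ = -1 := by
  unfold siteProd
  refine Finset.prod_induction _ (fun r : ℝ => r = 1 ∨ r = -1) ?_ (Or.inl rfl)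
    fun l _ => spin_eq_or _
  rintro a b (rfl | rfl) (rfl | rfl) <;> simp

lemma abs_siteProd {N p : ℕ} (x : Fin p → Fin N) (σ : Fin N → Bool) : |siteProd x σ| = 1 := by
  rcases siteProd_eq_or x σ with h | h <;> simp [h]

lemma abs_intSum_le {N p k : ℕ} (im : Fin p → Fin k → Fin N) (σ : Fin N → Bool) :
    |intSum im σ| ≤ k := by
  refine (Finset.abs_sum_le_sum_abs _ _).trans ?_
  have h : ∀ ν ∈ Finset.univ, |∏ l : Fin p, spin (σ (im l ν))| ≤ 1 := fun ν _ =>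
    (abs_siteProd (fun l => im l ν) σ).le
  simpa using Finset.sum_le_sum h

lemma Zpart_pos (β : ℝ) {N p k : ℕ} (im : Fin p → Fin k → Fin N) : 0 < Zpart β im :=
  Finset.sum_pos (fun _ _ => Real.exp_pos _) Finset.univ_nonempty

lemma abs_boltzmann_le (β : ℝ) {N p k : ℕ} (im : Fin p → Fin k → Fin N)
    {g : (Fin N → Bool) → ℝ} {C : ℝ} (hg : ∀ σ, |g σ| ≤ C) : |boltzmann β im g| ≤ C := by
  have hZ := Zpart_pos β im
  rw [boltzmann, abs_div, abs_of_pos hZ, div_le_iff₀ hZ, Zpart, Finset.mul_sum]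
  refine (Finset.abs_sum_le_sum_abs _ _).trans (Finset.sum_le_sum fun σ _ => ?_)
  rw [abs_mul, Real.abs_exp]
  exact mul_le_mul_of_nonneg_right (hg σ) (Real.exp_pos _).le

lemma boltzmann_sum (β : ℝ) {N p k : ℕ} (im : Fin p → Fin k → Fin N) {ι : Type*}
    (s : Finset ι) (g : ι → (Fin N → Bool) → ℝ) :
    boltzmann β im (fun σ => ∑ i ∈ s, g i σ) = ∑ i ∈ s, boltzmann β im (g i) := by
  simp only [boltzmann, Finset.sum_mul, ← Finset.sum_div]
  rw [Finset.sum_comm]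

lemma hasDerivAt_log_Zpart (β : ℝ) {N p k : ℕ} (im : Fin p → Fin k → Fin N) :
    HasDerivAt (fun b => Real.log (Zpart b im)) (boltzmann β im (intSum im)) β := by
  have h : HasDerivAt (fun b => Zpart b im)
      (∑ σ, intSum im σ * Real.exp (β * intSum im σ)) β := by
    unfold Zpart
    refine HasDerivAt.fun_sum fun σ _ => ?_
    simpa [mul_comm] using ((hasDerivAt_id β).mul_const (intSum im σ)).exp
  exact h.log (Zpart_pos β im).ne'

section avgIdx

variable {N p k : ℕ}

lemma avgIdx_const (hN : 0 < N) (c : ℝ) : avgIdx N p k (fun _ => c) = c := by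
  have : (N : ℝ) ≠ 0 := by positivity
  simp only [avgIdx, Finset.sum_const, Finset.card_univ, Fintype.card_fun, Fintype.card_fin,
    nsmul_eq_mul, Nat.cast_pow]
  rw [mul_comm p k, pow_mul]
  field_simp

lemma abs_avgIdx_le (hN : 0 < N) {f : (Fin p → Fin k → Fin N) → ℝ} {C : ℝ}
    (hf : ∀ im, |f im| ≤ C) : |avgIdx N p k f| ≤ C := by
  have h : |avgIdx N p k f| ≤ avgIdx N p k (fun _ => C) := by
    rw [avgIdx, avgIdx, abs_mul, abs_of_nonneg (by positivity : (0 : ℝ) ≤ ((N : ℝ) ^ (p * k))⁻¹)]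
    gcongr
    exact (Finset.abs_sum_le_sum_abs _ _).trans (Finset.sum_le_sum fun im _ => hf im)
  rwa [avgIdx_const hN] at h

lemma hasSum_avgIdx {ι : Type*} {f : ι → (Fin p → Fin k → Fin N) → ℝ}
    {g : (Fin p → Fin k → Fin N) → ℝ} (h : ∀ im, HasSum (fun n => f n im) (g im)) :
    HasSum (fun n => avgIdx N p k (f n)) (avgIdx N p k g) :=
  (hasSum_sum fun im _ => h im).mul_left _

lemma hasDerivAt_avgIdx {f : ℝ → (Fin p → Fin k → Fin N) → ℝ}
    {f' : (Fin p → Fin k → Fin N) → ℝ} {β : ℝ}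
    (h : ∀ im, HasDerivAt (fun b => f b im) (f' im) β) :
    HasDerivAt (fun b => avgIdx N p k (f b)) (avgIdx N p k f') β :=
  (HasDerivAt.fun_sum fun im _ => h im).const_mul _

lemma avgIdx_mul_left (c : ℝ) (f : (Fin p → Fin k → Fin N) → ℝ) :
    avgIdx N p k (fun im => c * f im) = c * avgIdx N p k f := by
  simp only [avgIdx, ← Finset.mul_sum]
  ring

lemma avgIdx_sub (f g : (Fin p → Fin k → Fin N) → ℝ) :
    avgIdx N p k (fun im => f im - g im) = avgIdx N p k f - avgIdx N p k g := by
  simp only [avgIdx, Finset.sum_sub_distrib, mul_sub]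

end avgIdx

/-- The average over `p` i.i.d. uniform sites. -/
def avgSite (N p : ℕ) (f : (Fin p → Fin N) → ℝ) : ℝ :=
  ((N : ℝ) ^ p)⁻¹ * ∑ x, f x

lemma avgSite_const {N p : ℕ} (hN : 0 < N) (c : ℝ) : avgSite N p (fun _ => c) = c := by
  have : (N : ℝ) ≠ 0 := by positivity
  simp only [avgSite, Finset.sum_const, Finset.card_univ, Fintype.card_fun, Fintype.card_fin,
    nsmul_eq_mul, Nat.cast_pow]
  field_simp

lemma avgSite_mul_left {N p : ℕ} (c : ℝ) (f : (Fin p → Fin N) → ℝ) :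
    avgSite N p (fun x => c * f x) = c * avgSite N p f := by
  simp only [avgSite, ← Finset.mul_sum]
  ring

lemma avgSite_sub {N p : ℕ} (f g : (Fin p → Fin N) → ℝ) :
    avgSite N p (fun x => f x - g x) = avgSite N p f - avgSite N p g := by
  simp only [avgSite, Finset.sum_sub_distrib, mul_sub]

/-- Index families with `k + 1` interactions, split into interaction `ν` and the other ones. -/
def insertInteraction (N p : ℕ) {k : ℕ} (ν : Fin (k + 1)) :
    (Fin p → Fin N) × (Fin p → Fin k → Fin N) ≃ (Fin p → Fin (k + 1) → Fin N) :=
  (Equiv.arrowProdEquivProdArrow (Fin p) (fun _ => Fin N) (fun _ => Fin k → Fin N)).symm.trans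
    (Equiv.piCongrRight fun _ => Fin.insertNthEquiv (fun _ => Fin N) ν)

lemma insertInteraction_self {N p k : ℕ} (ν : Fin (k + 1)) (x : Fin p → Fin N)
    (im : Fin p → Fin k → Fin N) (l : Fin p) : insertInteraction N p ν (x, im) l ν = x l := by
  simp [insertInteraction]

lemma insertInteraction_succAbove {N p k : ℕ} (ν : Fin (k + 1)) (x : Fin p → Fin N)
    (im : Fin p → Fin k → Fin N) (l : Fin p) (μ : Fin k) :
    insertInteraction N p ν (x, im) l (ν.succAbove μ) = im l μ := by
  simp [insertInteraction]

lemma intSum_insertInteraction {N p k : ℕ} (ν : Fin (k + 1)) (x : Fin p → Fin N)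
    (im : Fin p → Fin k → Fin N) (σ : Fin N → Bool) :
    intSum (insertInteraction N p ν (x, im)) σ = siteProd x σ + intSum im σ := by
  simp only [intSum, siteProd, Fin.sum_univ_succAbove _ ν, insertInteraction_self,
    insertInteraction_succAbove]

lemma exp_mul_siteProd (β : ℝ) {N p : ℕ} (x : Fin p → Fin N) (σ : Fin N → Bool) :
    Real.exp (β * siteProd x σ) = Real.cosh β * (1 + Real.tanh β * siteProd x σ) := by
  have hc := (Real.cosh_pos β).ne'
  have h : Real.cosh β * (1 + Real.tanh β * siteProd x σ) =
      Real.cosh β + Real.sinh β * siteProd x σ := by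
    rw [Real.tanh_eq_sinh_div_cosh]
    field_simp
  rw [h]
  rcases siteProd_eq_or x σ with h | h <;> rw [h]
  · rw [mul_one, mul_one, Real.cosh_add_sinh]
  · rw [mul_neg_one, mul_neg_one, ← sub_eq_add_neg, Real.cosh_sub_sinh]

lemma abs_boltzmann_siteProd_le (β : ℝ) {N p k : ℕ} (im : Fin p → Fin k → Fin N)
    (x : Fin p → Fin N) : |boltzmann β im (siteProd x)| ≤ 1 :=
  abs_boltzmann_le β im fun σ => (abs_siteProd x σ).le

lemma boltzmann_insertInteraction (β : ℝ) {N p k : ℕ} (ν : Fin (k + 1)) (x : Fin p → Fin N)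
    (im : Fin p → Fin k → Fin N) :
    boltzmann β (insertInteraction N p ν (x, im)) (siteProd x) =
      (boltzmann β im (siteProd x) + Real.tanh β) /
        (1 + Real.tanh β * boltzmann β im (siteProd x)) := by
  have hc := (Real.cosh_pos β).ne'
  have hZ := (Zpart_pos β im).ne'
  set S := ∑ σ, siteProd x σ * Real.exp (β * intSum im σ) with hS
  have hnum : ∑ σ, siteProd x σ * Real.exp (β * (siteProd x σ + intSum im σ)) =
      Real.cosh β * (S + Real.tanh β * Zpart β im) := by
    rw [hS, Zpart, Finset.mul_sum, ← Finset.sum_add_distrib, Finset.mul_sum]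
    refine Finset.sum_congr rfl fun σ _ => ?_
    have hsq : siteProd x σ ^ 2 = 1 := by
      rw [← sq_abs, abs_siteProd, one_pow]
    rw [mul_add, Real.exp_add, exp_mul_siteProd]
    linear_combination Real.cosh β * Real.tanh β * Real.exp (β * intSum im σ) * hsq
  have hden : ∑ σ, Real.exp (β * (siteProd x σ + intSum im σ)) =
      Real.cosh β * (Zpart β im + Real.tanh β * S) := by
    rw [hS, Zpart, Finset.mul_sum, ← Finset.sum_add_distrib, Finset.mul_sum]
    refine Finset.sum_congr rfl fun σ _ => ?_
    rw [mul_add, Real.exp_add, exp_mul_siteProd]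
    ring
  have hden' : Zpart β im + Real.tanh β * S ≠ 0 := by
    intro h0
    have hpos : 0 < ∑ σ : Fin N → Bool, Real.exp (β * (siteProd x σ + intSum im σ)) :=
      Finset.sum_pos (fun _ _ => Real.exp_pos _) Finset.univ_nonempty
    rw [hden, h0, mul_zero] at hpos
    exact hpos.false
  have hb : boltzmann β im (siteProd x) = S / Zpart β im := rfl
  rw [hb, boltzmann, Zpart]
  simp only [intSum_insertInteraction]
  rw [hnum, hden, mul_div_mul_left _ _ hc]
  have h1 : 1 + Real.tanh β * (S / Zpart β im) = (Zpart β im + Real.tanh β * S) / Zpart β im := by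
    field_simp
  have h2 : S / Zpart β im + Real.tanh β = (S + Real.tanh β * Zpart β im) / Zpart β im := by
    field_simp
  rw [h1, h2, div_div_div_cancel_right₀ hZ]

/-- Integrating out one of `k + 1` exchangeable interactions. -/
lemma avgIdx_boltzmann_intSum_succ (N p : ℕ) (β : ℝ) (k : ℕ) :
    avgIdx N p (k + 1) (fun im => boltzmann β im (intSum im)) =
      (k + 1) * avgIdx N p k (fun im => avgSite N p fun x =>
        (boltzmann β im (siteProd x) + Real.tanh β) /
          (1 + Real.tanh β * boltzmann β im (siteProd x))) := by
  have hsplit : ∀ im : Fin p → Fin (k + 1) → Fin N, boltzmann β im (intSum im) =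
      ∑ ν, boltzmann β im (siteProd fun l => im l ν) := fun im =>
    boltzmann_sum β im Finset.univ fun ν => siteProd fun l => im l ν
  have hν : ∀ ν : Fin (k + 1), ∑ im : Fin p → Fin (k + 1) → Fin N,
      boltzmann β im (siteProd fun l => im l ν) =
      ∑ im : Fin p → Fin k → Fin N, ∑ x : Fin p → Fin N,
        (boltzmann β im (siteProd x) + Real.tanh β) /
          (1 + Real.tanh β * boltzmann β im (siteProd x)) := by
    intro ν
    rw [← (insertInteraction N p ν).sum_comp, Fintype.sum_prod_type_right]
    simp only [insertInteraction_self, boltzmann_insertInteraction]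
  simp only [avgIdx, avgSite, hsplit]
  rw [Finset.sum_comm]
  simp only [hν, Finset.sum_const, Finset.card_univ, Fintype.card_fin, nsmul_eq_mul,
    ← Finset.mul_sum, mul_add, mul_one, pow_add, mul_inv]
  push_cast
  ring

/-- Moments of multi-overlaps are site averages of powers of correlation functions. -/
lemma OmegaB_qOv_pow (β : ℝ) {N p k : ℕ} (im : Fin p → Fin k → Fin N) (n r : ℕ) :
    OmegaB β im n (fun σs => qOv N n σs ^ r) =
      avgSite N r fun x => boltzmann β im (siteProd x) ^ n := by
  have hq : ∀ σs : Fin n → Fin N → Bool, qOv N n σs ^ r =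
      ((N : ℝ) ^ r)⁻¹ * ∑ x : Fin r → Fin N, ∏ a, siteProd x (σs a) := by
    intro σs
    rw [qOv, mul_pow, inv_pow, Fintype.sum_pow]
    congr 1
    refine Finset.sum_congr rfl fun x _ => ?_
    simp only [siteProd]
    rw [Finset.prod_comm]
  simp only [OmegaB, avgSite, hq, boltzmann, div_pow, Fintype.sum_pow, Finset.prod_mul_distrib,
    ← Finset.sum_div, mul_div_assoc', Finset.mul_sum, Finset.sum_mul, mul_assoc]
  rw [Finset.sum_comm]

lemma hasSum_neg_div_one_add_mul {θ m : ℝ} (hθ : |θ| < 1) (hm : |m| ≤ 1) :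
    HasSum (fun n : ℕ => (-1 : ℝ) ^ (n + 1) * θ ^ n * m ^ (n + 1)) (-(m / (1 + θ * m))) := by
  have h : |-(θ * m)| < 1 := by
    rw [abs_neg, abs_mul]
    exact (mul_le_of_le_one_right (abs_nonneg _) hm).trans_lt hθ
  have hs := (hasSum_geometric_of_abs_lt_one h).mul_left (-m)
  rw [sub_neg_eq_add, ← div_eq_mul_inv, neg_div] at hs
  have hterm : ∀ n : ℕ, (-1 : ℝ) ^ (n + 1) * θ ^ n * m ^ (n + 1) = -m * (-(θ * m)) ^ n := by
    intro n
    rw [← neg_mul, mul_pow, neg_pow θ n]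
    ring
  simpa only [hterm] using hs

lemma add_div_one_add_mul {θ m : ℝ} (hθ : |θ| < 1) (hm : |m| ≤ 1) :
    (m + θ) / (1 + θ * m) = θ - (1 - θ ^ 2) * -(m / (1 + θ * m)) := by
  have h : |θ * m| < 1 := by
    rw [abs_mul]
    exact (mul_le_of_le_one_right (abs_nonneg _) hm).trans_lt hθ
  have h0 : 1 + θ * m ≠ 0 := ne_of_gt (by linarith [(abs_lt.1 h).1])
  rw [mul_neg, sub_neg_eq_add, ← mul_div_assoc, eq_comm, ← eq_sub_iff_add_eq', div_sub' h0,
    div_left_inj' h0]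
  ring

lemma pois_nonneg {lam : ℝ} (h : 0 ≤ lam) (k : ℕ) : 0 ≤ pois lam k := by
  unfold pois
  positivity

lemma hasSum_pois (lam : ℝ) : HasSum (pois lam) 1 := by
  have h := (NormedSpace.expSeries_div_hasSum_exp lam).mul_left (Real.exp (-lam))
  rw [← Real.exp_eq_exp_ℝ, ← Real.exp_add, neg_add_cancel, Real.exp_zero] at h
  have hpois : pois lam = fun k => Real.exp (-lam) * (lam ^ k / k.factorial) :=
    funext fun k => mul_div_assoc _ _ _
  rwa [hpois]

lemma pois_succ_mul (lam : ℝ) (k : ℕ) : pois lam (k + 1) * (k + 1) = lam * pois lam k := by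
  rw [pois, pois, Nat.factorial_succ]
  push_cast
  have : (k : ℝ) + 1 ≠ 0 := by positivity
  field_simp
  ring

lemma summable_pois_mul_self (lam : ℝ) : Summable fun k : ℕ => pois lam k * k := by
  rw [← summable_nat_add_iff 1]
  simpa [pois_succ_mul] using (hasSum_pois lam).summable.mul_left lam

section Equench

variable {N p : ℕ} {γ : ℝ}

lemma summable_Equench (hN : 0 < N) (hγ : 0 ≤ γ)
    {f : (k : ℕ) → (Fin p → Fin k → Fin N) → ℝ} {C : ℝ} (hf : ∀ k im, |f k im| ≤ C) :
    Summable fun k => pois (γ * N) k * avgIdx N p k (f k) := by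
  refine Summable.of_norm_bounded ((hasSum_pois (γ * N)).summable.mul_right C) fun k => ?_
  rw [Real.norm_eq_abs, abs_mul, abs_of_nonneg (pois_nonneg (by positivity) k)]
  exact mul_le_mul_of_nonneg_left (abs_avgIdx_le hN (hf k)) (pois_nonneg (by positivity) k)

lemma abs_Equench_le (hN : 0 < N) (hγ : 0 ≤ γ)
    {f : (k : ℕ) → (Fin p → Fin k → Fin N) → ℝ} {C : ℝ} (hf : ∀ k im, |f k im| ≤ C) :
    |Equench N p γ f| ≤ C := by
  have h := (hasSum_pois (γ * N)).mul_right C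
  rw [one_mul] at h
  rw [Equench, ← Real.norm_eq_abs]
  refine tsum_of_norm_bounded h fun k => ?_
  rw [Real.norm_eq_abs, abs_mul, abs_of_nonneg (pois_nonneg (by positivity) k)]
  exact mul_le_mul_of_nonneg_left (abs_avgIdx_le hN (hf k)) (pois_nonneg (by positivity) k)

lemma Equench_const (hN : 0 < N) (c : ℝ) : Equench N p γ (fun _ _ => c) = c := by
  simp only [Equench, avgIdx_const hN, tsum_mul_right, (hasSum_pois _).tsum_eq, one_mul]

/-- The quenched expectation commutes with dominated series. -/
lemma Equench_tsum (hN : 0 < N) (hγ : 0 ≤ γ)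
    {f : ℕ → (k : ℕ) → (Fin p → Fin k → Fin N) → ℝ}
    {g : (k : ℕ) → (Fin p → Fin k → Fin N) → ℝ} {u : ℕ → ℝ} (hu : Summable u)
    (hf : ∀ n k im, |f n k im| ≤ u n) (hg : ∀ k im, HasSum (fun n => f n k im) (g k im)) :
    Equench N p γ g = ∑' n, Equench N p γ (f n) := by
  have hpois : ∀ k, 0 ≤ pois (γ * N) k := pois_nonneg (by positivity)
  have hu0 : ∀ n, 0 ≤ avgIdx N p 0 (fun _ => u n) := by
    intro n
    rw [avgIdx_const hN]
    exact (abs_nonneg _).trans (hf n 0 fun _ => Fin.elim0)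
  simp only [avgIdx_const hN] at hu0
  have hsum : Summable (Function.uncurry fun k n => pois (γ * N) k * avgIdx N p k (f n k)) := by
    refine Summable.of_norm_bounded
      ((hasSum_pois (γ * N)).summable.mul_of_nonneg hu hpois hu0) fun x => ?_
    rw [Function.uncurry, Real.norm_eq_abs, abs_mul, abs_of_nonneg (hpois _)]
    exact mul_le_mul_of_nonneg_left (abs_avgIdx_le hN (hf x.2 x.1)) (hpois _)
  unfold Equench
  rw [hsum.tsum_comm]
  refine tsum_congr fun k => ?_
  rw [tsum_mul_left, (hasSum_avgIdx (hg k)).tsum_eq]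

end Equench

lemma hasDerivAt_ElnZ {N p : ℕ} (hN : 0 < N) {γ : ℝ} (hγ : 0 ≤ γ) (β : ℝ) :
    HasDerivAt (fun b => ElnZ N p γ b)
      (Equench N p γ fun _ im => boltzmann β im (intSum im)) β := by
  refine hasDerivAt_tsum (y₀ := 0) (summable_pois_mul_self (γ * N))
    (fun k b => (hasDerivAt_avgIdx fun im => hasDerivAt_log_Zpart b im).const_mul _)
    (fun k b => ?_) ?_ β
  · rw [Real.norm_eq_abs, abs_mul, abs_of_nonneg (pois_nonneg (by positivity) k)]
    exact mul_le_mul_of_nonneg_left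
      (abs_avgIdx_le hN fun im => abs_boltzmann_le b im (abs_intSum_le im))
      (pois_nonneg (by positivity) k)
  · simp only [Zpart, zero_mul, Real.exp_zero]
    exact summable_Equench hN hγ fun _ _ => le_rfl

/-- Poisson integration by parts for the internal energy. -/
lemma Equench_boltzmann_intSum {N p : ℕ} (hN : 0 < N) {γ : ℝ} (hγ : 0 ≤ γ) (β : ℝ) :
    (Equench N p γ fun _ im => boltzmann β im (intSum im)) =
      γ * N * Equench N p γ fun _ im => avgSite N p fun x =>
        (boltzmann β im (siteProd x) + Real.tanh β) /
          (1 + Real.tanh β * boltzmann β im (siteProd x)) := by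
  have hs : Summable fun k => pois (γ * N) k *
      avgIdx N p k (fun im => boltzmann β im (intSum im)) := by
    refine Summable.of_norm_bounded (summable_pois_mul_self (γ * N)) fun k => ?_
    rw [Real.norm_eq_abs, abs_mul, abs_of_nonneg (pois_nonneg (by positivity) k)]
    exact mul_le_mul_of_nonneg_left
      (abs_avgIdx_le hN fun im => abs_boltzmann_le β im (abs_intSum_le im))
      (pois_nonneg (by positivity) k)
  rw [Equench, hs.tsum_eq_zero_add, Equench, ← tsum_mul_left]
  have h0 : avgIdx N p 0 (fun im => boltzmann β im (intSum im)) = 0 := by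
    simp [avgIdx, boltzmann, intSum]
  rw [h0, mul_zero, zero_add]
  refine tsum_congr fun k => ?_
  rw [avgIdx_boltzmann_intSum_succ, ← mul_assoc, pois_succ_mul, mul_assoc]

lemma abs_OmegaB_qOv_pow_le (β : ℝ) {N p k : ℕ} (hN : 0 < N) (im : Fin p → Fin k → Fin N)
    (n : ℕ) : |OmegaB β im n (fun σs => qOv N n σs ^ p)| ≤ 1 := by
  rw [OmegaB_qOv_pow, ← avgSite_const (N := N) (p := p) hN 1, avgSite, avgSite, abs_mul,
    abs_of_nonneg (by positivity : (0 : ℝ) ≤ ((N : ℝ) ^ p)⁻¹)]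
  gcongr
  refine (Finset.abs_sum_le_sum_abs _ _).trans (Finset.sum_le_sum fun x _ => ?_)
  rw [abs_pow]
  exact pow_le_one₀ (abs_nonneg _) (abs_boltzmann_siteProd_le β im x)

/-- `β`-streaming of the quenched pressure of the diluted `p`-spin model. -/
theorem pSpin_pressure_beta_derivative {N p : ℕ} (hN : 0 < N) {γ : ℝ} (hγ : 0 ≤ γ) (β : ℝ) :
    Summable (fun n : ℕ =>
      |(-1 : ℝ) ^ (n + 1) * Real.tanh β ^ n * qPowAvg N p γ β (n + 1) p|) ∧
    HasDerivAt (fun b : ℝ => pressure N p γ b)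
      (γ * Real.tanh β -
        γ * (1 - Real.tanh β ^ 2) *
          ∑' n : ℕ, (-1 : ℝ) ^ (n + 1) * Real.tanh β ^ n * qPowAvg N p γ β (n + 1) p) β := by
  have hN' : (N : ℝ) ≠ 0 := by positivity
  have hθ := Real.abs_tanh_lt_one β
  set θ := Real.tanh β with hθdef
  have hgeom : Summable fun n : ℕ => |θ| ^ n := summable_geometric_of_lt_one (abs_nonneg _) hθ
  have hcoef : ∀ (n : ℕ) (Q : ℝ), |Q| ≤ 1 → |(-1 : ℝ) ^ (n + 1) * θ ^ n * Q| ≤ |θ| ^ n := by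
    intro n Q hQ
    rw [abs_mul, abs_mul, abs_pow, abs_neg, abs_one, one_pow, one_mul, abs_pow]
    exact mul_le_of_le_one_right (by positivity) hQ
  refine ⟨Summable.of_nonneg_of_le (fun _ => abs_nonneg _) (fun n => hcoef n _
    (abs_Equench_le hN hγ fun k im => abs_OmegaB_qOv_pow_le β hN im _)) hgeom, ?_⟩
  refine ((hasDerivAt_ElnZ hN hγ β).const_mul (N : ℝ)⁻¹).congr_deriv ?_
  set g : (k : ℕ) → (Fin p → Fin k → Fin N) → ℝ := fun _ im => avgSite N p fun x =>
    -(boltzmann β im (siteProd x) / (1 + θ * boltzmann β im (siteProd x))) with hgdef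
  have hg : ∀ (k : ℕ) (im : Fin p → Fin k → Fin N), HasSum (fun n : ℕ =>
      (-1 : ℝ) ^ (n + 1) * θ ^ n * OmegaB β im (n + 1) (fun σs => qOv N (n + 1) σs ^ p))
      (g k im) := by
    intro k im
    have h := (hasSum_sum fun x (_ : x ∈ Finset.univ) => hasSum_neg_div_one_add_mul hθ
      (abs_boltzmann_siteProd_le β im x)).mul_left ((N : ℝ) ^ p)⁻¹
    simpa only [hgdef, OmegaB_qOv_pow, avgSite, ← Finset.mul_sum, mul_left_comm] using h
  have hgbound : ∀ (k : ℕ) (im : Fin p → Fin k → Fin N), |g k im| ≤ ∑' n : ℕ, |θ| ^ n := by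
    intro k im
    rw [← (hg k im).tsum_eq, ← Real.norm_eq_abs]
    exact tsum_of_norm_bounded hgeom.hasSum fun n =>
      hcoef n _ (abs_OmegaB_qOv_pow_le β hN im _)
  have hR : ∀ (k : ℕ) (im : Fin p → Fin k → Fin N), (avgSite N p fun x =>
      (boltzmann β im (siteProd x) + θ) / (1 + θ * boltzmann β im (siteProd x))) =
      θ - (1 - θ ^ 2) * g k im := by
    intro k im
    simp only [add_div_one_add_mul hθ (abs_boltzmann_siteProd_le β im _)]
    rw [avgSite_sub, avgSite_mul_left, avgSite_const hN]
  have hE : Equench N p γ g =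
      ∑' n : ℕ, (-1 : ℝ) ^ (n + 1) * θ ^ n * qPowAvg N p γ β (n + 1) p := by
    rw [Equench_tsum hN hγ hgeom
      (fun n k im => hcoef n _ (abs_OmegaB_qOv_pow_le β hN im _)) hg]
    refine tsum_congr fun n => ?_
    simp only [qPowAvg, Equench, avgIdx_mul_left, mul_left_comm (pois _ _), tsum_mul_left]
  rw [Equench_boltzmann_intSum hN hγ, ← hE]
  simp only [← hθdef, hR]
  have hlin : (Equench N p γ fun k im => θ - (1 - θ ^ 2) * g k im) =
      θ - (1 - θ ^ 2) * Equench N p γ g := by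
    have h1 := summable_Equench (p := p) hN hγ (f := fun _ _ => θ) fun _ _ => le_rfl
    have h2 := (summable_Equench hN hγ hgbound).mul_left (1 - θ ^ 2)
    have h3 := h1.tsum_sub h2
    rw [tsum_mul_left] at h3
    refine Eq.trans ?_ (h3.trans (congrArg (· - _) (Equench_const hN θ)))
    refine tsum_congr fun k => ?_
    rw [avgIdx_sub, avgIdx_mul_left]
    ring
  rw [hlin]
  field_simp

end

/-- `β`-streaming of the quenched pressure of the diluted Curie–Weiss model (`p = 2`,
`γ = α`): `∂_β A_N(α,β) = αθ - α(1-θ²) ∑_{n≥1} (-1)^n θ^{n-1} ⟨q_{1…n}²⟩_N`,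
with `θ = tanh β`, the series being absolutely convergent. -/
theorem pressure_beta_derivative (N : ℕ) (hN : 0 < N) (α β : ℝ) (hα : 0 < α) (hβ : 0 < β) :
    Summable (fun n : ℕ =>
      |(-1 : ℝ) ^ (n + 1) * Real.tanh β ^ n * qPowAvg N 2 α β (n + 1) 2|) ∧
    HasDerivAt (fun b : ℝ => pressure N 2 α b)
      (α * Real.tanh β -
        α * (1 - Real.tanh β ^ 2) *
          ∑' n : ℕ, (-1 : ℝ) ^ (n + 1) * Real.tanh β ^ n * qPowAvg N 2 α β (n + 1) 2) β :=
  pSpin_pressure_beta_derivative hN hα.le β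
end
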